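/- arXiv:2008.03643 — 2 statements merged into one kernel-verified Lean document; each statement's English description precedes it below -/
import Mathlib

section
/- Let X →u Y →v Z →w ΣX be a distinguished triangle, and let X⊕X'' →M Y⊕Y'' →[v₁' v₂'] Z' →(w₁';w₂') ΣX⊕ΣX'' be a distinguished triangle, where M is the matrix [[u, c],[0, u'']] for some morphisms c: X''→Y and u'': X''→Y''. Suppose h: Z→Z' is such that the triple (inc_X, inc_Y, h), whose first, second, and fourth vertical components are the canonical direct-summand inclusions X→X⊕X'', Y→Y⊕Y'', ΣX→ΣX⊕ΣX'', is a map of triangles. Then the following are equivalent: (a) this map of triangles is good; (b) it is Verdier good; (c) the candidate triangle X'' →(v∘c; u'') Z⊕Y'' →[h v₂'] Z' →w₂' ΣX'' is a distinguished triangle. Moreover, if c = 0, then these conditions hold for every such h. -/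
open CategoryTheory Category Limits Pretriangulated

universe v u

variable {C : Type u} [Category.{v} C] [Preadditive C] [HasZeroObject C]
  [HasShift C ℤ] [∀ n : ℤ, (shiftFunctor C n).Additive] [Pretriangulated C]
  [IsTriangulated C] [HasBinaryBiproducts C]

noncomputable local instance (n : ℤ) : PreservesBinaryBiproducts (shiftFunctor C n) :=
  preservesBinaryBiproducts_of_preservesBiproducts _

/-- The condition that `(f, g, h)` is a morphism of triangles from `T` to `T'`. -/
def IsTriMap (T T' : Triangle C) (f : T.obj₁ ⟶ T'.obj₁) (g : T.obj₂ ⟶ T'.obj₂)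
    (h : T.obj₃ ⟶ T'.obj₃) : Prop :=
  T.mor₁ ≫ g = f ≫ T'.mor₁ ∧ T.mor₂ ≫ h = g ≫ T'.mor₂ ∧
    T.mor₃ ≫ f⟦(1 : ℤ)⟧' = h ≫ T'.mor₃

/-- The mapping cone of a morphism of triangles. -/
noncomputable def mappingCone (T T' : Triangle C) (f : T.obj₁ ⟶ T'.obj₁)
    (g : T.obj₂ ⟶ T'.obj₂) (h : T.obj₃ ⟶ T'.obj₃) : Triangle C :=
  Triangle.mk
    (biprod.desc (biprod.lift T'.mor₁ 0) (biprod.lift g (-T.mor₂)) :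
      T'.obj₁ ⊞ T.obj₂ ⟶ T'.obj₂ ⊞ T.obj₃)
    (biprod.desc (biprod.lift T'.mor₂ 0) (biprod.lift h (-T.mor₃)) :
      T'.obj₂ ⊞ T.obj₃ ⟶ T'.obj₃ ⊞ T.obj₁⟦(1 : ℤ)⟧)
    (biprod.desc (biprod.lift T'.mor₃ 0)
        (biprod.lift (f⟦(1 : ℤ)⟧') (-(T.mor₁⟦(1 : ℤ)⟧'))) ≫
      ((shiftFunctor C (1 : ℤ)).mapBiprod T'.obj₁ T.obj₂).inv)

/-- A morphism of triangles is good if its mapping cone is distinguished. -/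
noncomputable def IsGood (T T' : Triangle C) (f : T.obj₁ ⟶ T'.obj₁)
    (g : T.obj₂ ⟶ T'.obj₂) (h : T.obj₃ ⟶ T'.obj₃) : Prop :=
  mappingCone T T' f g h ∈ distTriang C

/-- An octahedron on composable maps `a`, `b`, given distinguished triangles
`(a, p₁, q₁)`, `(b, p₂, q₂)` and `(a ≫ b, p₃, q₃)`, is a pair `(m, n)` as below. -/
def IsOctahedron {A₁ A₂ A₃ B₁ B₂ B₃ : C} (a : A₁ ⟶ A₂) (b : A₂ ⟶ A₃)
    (p₁ : A₂ ⟶ B₁) (q₁ : B₁ ⟶ A₁⟦(1 : ℤ)⟧)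
    (p₂ : A₃ ⟶ B₂) (q₂ : B₂ ⟶ A₂⟦(1 : ℤ)⟧)
    (p₃ : A₃ ⟶ B₃) (q₃ : B₃ ⟶ A₁⟦(1 : ℤ)⟧)
    (m : B₁ ⟶ B₃) (n : B₃ ⟶ B₂) : Prop :=
  p₁ ≫ m = b ≫ p₃ ∧ m ≫ q₃ = q₁ ∧ p₃ ≫ n = p₂ ∧ n ≫ q₂ = q₃ ≫ a⟦(1 : ℤ)⟧' ∧
    (Triangle.mk m n (q₂ ≫ p₁⟦(1 : ℤ)⟧') ∈ distTriang C)

/-- A morphism of triangles `(f, g, h)` is Verdier good if `h` arises from Verdier's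
construction via two octahedra on the composite `g ∘ u = u' ∘ f`. -/
def IsVerdierGood (T T' : Triangle C) (f : T.obj₁ ⟶ T'.obj₁) (g : T.obj₂ ⟶ T'.obj₂)
    (h : T.obj₃ ⟶ T'.obj₃) : Prop :=
  ∃ (A Y'' X'' : C) (vt : T'.obj₂ ⟶ A) (wt : A ⟶ T.obj₁⟦(1 : ℤ)⟧)
    (g' : T'.obj₂ ⟶ Y'') (g'' : Y'' ⟶ T.obj₂⟦(1 : ℤ)⟧)
    (f' : T'.obj₁ ⟶ X'') (f'' : X'' ⟶ T.obj₁⟦(1 : ℤ)⟧)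
    (α₁ : T.obj₃ ⟶ A) (β₁ : A ⟶ Y'') (α₂ : X'' ⟶ A) (β₂ : A ⟶ T'.obj₃),
    (Triangle.mk (T.mor₁ ≫ g) vt wt ∈ distTriang C) ∧
    (Triangle.mk g g' g'' ∈ distTriang C) ∧
    (Triangle.mk f f' f'' ∈ distTriang C) ∧
    IsOctahedron T.mor₁ g T.mor₂ T.mor₃ g' g'' vt wt α₁ β₁ ∧
    IsOctahedron f T'.mor₁ f' f'' T'.mor₂ T'.mor₃ vt wt α₂ β₂ ∧
    h = α₁ ≫ β₂

/-- The morphism of triangles `(f, g, h)` is nullhomotopic, in the (equivalent)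
`Σ`-applied formulation of the first equation. -/
def IsNullHomotopic (T T' : Triangle C) (f : T.obj₁ ⟶ T'.obj₁) (g : T.obj₂ ⟶ T'.obj₂)
    (h : T.obj₃ ⟶ T'.obj₃) : Prop :=
  ∃ (F : T.obj₂ ⟶ T'.obj₁) (G : T.obj₃ ⟶ T'.obj₂) (H : T.obj₁⟦(1 : ℤ)⟧ ⟶ T'.obj₃),
    f⟦(1 : ℤ)⟧' = T.mor₁⟦(1 : ℤ)⟧' ≫ F⟦(1 : ℤ)⟧' + H ≫ T'.mor₃ ∧
    g = T.mor₂ ≫ G + F ≫ T'.mor₁ ∧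
    h = T.mor₃ ≫ H + G ≫ T'.mor₂

/-- A triangle is contractible if its identity morphism is nullhomotopic. -/
def IsContractible (T : Triangle C) : Prop :=
  IsNullHomotopic T T (𝟙 T.obj₁) (𝟙 T.obj₂) (𝟙 T.obj₃)

/-- A morphism of triangles is middling good if it extends to a 4 × 4 diagram. -/
def IsMiddlingGood (T T' : Triangle C) (f : T.obj₁ ⟶ T'.obj₁) (g : T.obj₂ ⟶ T'.obj₂)
    (h : T.obj₃ ⟶ T'.obj₃) : Prop :=
  ∃ (X'' Y'' Z'' : C)
    (f' : T'.obj₁ ⟶ X'') (f'' : X'' ⟶ T.obj₁⟦(1 : ℤ)⟧)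
    (g' : T'.obj₂ ⟶ Y'') (g'' : Y'' ⟶ T.obj₂⟦(1 : ℤ)⟧)
    (h' : T'.obj₃ ⟶ Z'') (h'' : Z'' ⟶ T.obj₃⟦(1 : ℤ)⟧)
    (u'' : X'' ⟶ Y'') (v'' : Y'' ⟶ Z'') (w'' : Z'' ⟶ X''⟦(1 : ℤ)⟧),
    (Triangle.mk f f' f'' ∈ distTriang C) ∧
    (Triangle.mk g g' g'' ∈ distTriang C) ∧
    (Triangle.mk h h' h'' ∈ distTriang C) ∧
    (Triangle.mk u'' v'' w'' ∈ distTriang C) ∧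
    T'.mor₁ ≫ g' = f' ≫ u'' ∧
    T'.mor₂ ≫ h' = g' ≫ v'' ∧
    T'.mor₃ ≫ f'⟦(1 : ℤ)⟧' = h' ≫ w'' ∧
    u'' ≫ g'' = f'' ≫ T.mor₁⟦(1 : ℤ)⟧' ∧
    v'' ≫ h'' = g'' ≫ T.mor₂⟦(1 : ℤ)⟧' ∧
    h'' ≫ T.mor₃⟦(1 : ℤ)⟧' = -(w'' ≫ f''⟦(1 : ℤ)⟧')

/-- A candidate triangle `(a, b, c)` is replaceably exact if each of its three maps
can be replaced to give a distinguished triangle. -/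
def ReplaceablyExact {A B D : C} (a : A ⟶ B) (b : B ⟶ D) (c : D ⟶ A⟦(1 : ℤ)⟧) : Prop :=
  (∃ a' : A ⟶ B, Triangle.mk a' b c ∈ distTriang C) ∧
  (∃ b' : B ⟶ D, Triangle.mk a b' c ∈ distTriang C) ∧
  (∃ c' : D ⟶ A⟦(1 : ℤ)⟧, Triangle.mk a b c' ∈ distTriang C)

set_option linter.unusedSectionVars false

/-- A triangle that is a biproduct of two distinguished triangles is distinguished. -/
lemma distinguished_of_bicone {T₁ T₂ : Triangle C} (b : BinaryBicone T₁ T₂)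
    (total : b.fst ≫ b.inl + b.snd ≫ b.inr = 𝟙 b.pt)
    (h₁ : T₁ ∈ distTriang C) (h₂ : T₂ ∈ distTriang C) : b.pt ∈ distTriang C := by
  let T : WalkingPair → Triangle C := fun j => WalkingPair.casesOn j T₁ T₂
  have hT : ∀ j, T j ∈ distTriang C := by rintro (_ | _) <;> assumption
  have lim := productTriangle.isLimitFan T
  let p : ∀ j, b.pt ⟶ T j := fun j => WalkingPair.casesOn j b.fst b.snd
  let φ : b.pt ⟶ productTriangle T := Fan.IsLimit.lift lim p
  have hφ₁ : φ ≫ productTriangle.π T .left = b.fst := Fan.IsLimit.fac lim p .left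
  have hφ₂ : φ ≫ productTriangle.π T .right = b.snd := Fan.IsLimit.fac lim p .right
  let ψ : productTriangle T ⟶ b.pt :=
    productTriangle.π T .left ≫ b.inl + productTriangle.π T .right ≫ b.inr
  refine isomorphic_distinguished _ (productTriangle_distinguished T hT) _ ⟨φ, ψ, ?_, ?_⟩
  · rw [Preadditive.comp_add, reassoc_of% hφ₁, reassoc_of% hφ₂, total]
  · refine Fan.IsLimit.hom_ext lim _ _ ?_
    rintro (_ | _)
    · change (ψ ≫ φ) ≫ productTriangle.π T .left = 𝟙 _ ≫ productTriangle.π T .left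
      rw [assoc, hφ₁, Preadditive.add_comp, assoc, assoc, b.inl_fst, b.inr_fst, comp_id,
        comp_zero, add_zero, id_comp]
    · change (ψ ≫ φ) ≫ productTriangle.π T .right = 𝟙 _ ≫ productTriangle.π T .right
      rw [assoc, hφ₂, Preadditive.add_comp, assoc, assoc, b.inl_snd, b.inr_snd, comp_id,
        comp_zero, zero_add, id_comp]

/-- A retract of a distinguished triangle is distinguished. -/
lemma distinguished_of_retract {T D : Triangle C} (e : Retract T D)
    (hD : D ∈ distTriang C) : T ∈ distTriang C := by
  obtain ⟨Z, g, k, hE⟩ := distinguished_cocone_triangle T.mor₁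
  have e₁ : e.i.hom₁ ≫ e.r.hom₁ = 𝟙 _ := by rw [← comp_hom₁, e.retract, id_hom₁]
  have e₂ : e.i.hom₂ ≫ e.r.hom₂ = 𝟙 _ := by rw [← comp_hom₂, e.retract, id_hom₂]
  have e₃ : e.i.hom₃ ≫ e.r.hom₃ = 𝟙 _ := by rw [← comp_hom₃, e.retract, id_hom₃]
  let a : Triangle.mk T.mor₁ g k ⟶ D :=
    completeDistinguishedTriangleMorphism _ _ hE hD e.i.hom₁ e.i.hom₂ e.i.comm₁
  let b : D ⟶ Triangle.mk T.mor₁ g k :=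
    completeDistinguishedTriangleMorphism _ _ hD hE e.r.hom₁ e.r.hom₂ e.r.comm₁
  let φ : T ⟶ Triangle.mk T.mor₁ g k := e.i ≫ b
  let ψ : Triangle.mk T.mor₁ g k ⟶ T := a ≫ e.r
  have hφ₁ : φ.hom₁ = 𝟙 _ := e₁
  have hφ₂ : φ.hom₂ = 𝟙 _ := e₂
  have hψ₁ : ψ.hom₁ = 𝟙 _ := e₁
  have hψ₂ : ψ.hom₂ = 𝟙 _ := e₂
  have hψφ : IsIso (ψ.hom₃ ≫ φ.hom₃) := by
    refine isIso₃_of_isIso₁₂ (ψ ≫ φ) hE hE ?_ ?_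
    · rw [comp_hom₁, hφ₁, hψ₁]; exact inferInstanceAs (IsIso (𝟙 _ ≫ 𝟙 _))
    · rw [comp_hom₂, hφ₂, hψ₂]; exact inferInstanceAs (IsIso (𝟙 _ ≫ 𝟙 _))
  have hφψ : IsIso (φ.hom₃ ≫ ψ.hom₃) := by
    let n := φ.hom₃ ≫ ψ.hom₃ - 𝟙 T.obj₃
    have h₁ : (φ ≫ ψ).hom₁ = 𝟙 T.obj₁ := by
      rw [comp_hom₁, hφ₁, hψ₁]; exact id_comp _
    have h₂ : (φ ≫ ψ).hom₂ = 𝟙 T.obj₂ := by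
      rw [comp_hom₂, hφ₂, hψ₂]; exact id_comp _
    have hn₂ : T.mor₂ ≫ n = 0 := by
      have := (φ ≫ ψ).comm₂
      rw [h₂, id_comp, comp_hom₃] at this
      rw [Preadditive.comp_sub, this, comp_id, sub_self]
    have hn₃ : n ≫ T.mor₃ = 0 := by
      have := (φ ≫ ψ).comm₃
      rw [h₁, CategoryTheory.Functor.map_id, comp_id, comp_hom₃] at this
      rw [Preadditive.sub_comp, ← this, id_comp, sub_self]
    obtain ⟨t, ht⟩ := D.yoneda_exact₃ hD (e.r.hom₃ ≫ n ≫ e.i.hom₃) (by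
      rw [reassoc_of% e.r.comm₂, reassoc_of% hn₂, zero_comp, comp_zero])
    have hnn : n ≫ n = 0 := by
      have h₁ : (n ≫ e.i.hom₃) ≫ (e.r.hom₃ ≫ n ≫ e.i.hom₃) = 0 := by
        rw [ht, assoc, ← reassoc_of% e.i.comm₃, reassoc_of% hn₃, zero_comp]
      have h₂ := h₁ =≫ e.r.hom₃
      simpa only [assoc, e₃, comp_id, zero_comp, reassoc_of% e₃] using h₂
    have h₁ : φ.hom₃ ≫ ψ.hom₃ = 𝟙 _ + n := by simp [n]
    rw [h₁]
    exact ⟨𝟙 _ - n, by simp [hnn], by simp [hnn]⟩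
  have hφ₃ : IsIso φ.hom₃ := by
    have : Mono φ.hom₃ := mono_of_mono φ.hom₃ ψ.hom₃
    have : IsSplitEpi φ.hom₃ := ⟨⟨inv (ψ.hom₃ ≫ φ.hom₃) ≫ ψ.hom₃, by simp⟩⟩
    exact isIso_of_mono_of_isSplitEpi _
  have : IsIso φ := Triangle.isIso_of_isIsos φ (by rw [hφ₁]; exact inferInstanceAs (IsIso (𝟙 _)))
    (by rw [hφ₂]; exact inferInstanceAs (IsIso (𝟙 _))) hφ₃
  exact isomorphic_distinguished _ hE _ (asIso φ)

/-- The first summand of a biproduct triangle is a retract of it. -/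
lemma distinguished_left_of_bicone {T₁ T₂ : Triangle C} (b : BinaryBicone T₁ T₂)
    (h : b.pt ∈ distTriang C) : T₁ ∈ distTriang C :=
  distinguished_of_retract ⟨b.inl, b.fst, b.inl_fst⟩ h

lemma shift_map_comp_eq_id {A B : C} {i : A ⟶ B} {p : B ⟶ A} (h : i ≫ p = 𝟙 A) :
    i⟦(1 : ℤ)⟧' ≫ p⟦(1 : ℤ)⟧' = 𝟙 (A⟦(1 : ℤ)⟧) := by
  rw [← Functor.map_comp, h, CategoryTheory.Functor.map_id]

lemma shift_map_comp_eq_zero {A B D : C} {i : A ⟶ B} {p : B ⟶ D} (h : i ≫ p = 0) :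
    i⟦(1 : ℤ)⟧' ≫ p⟦(1 : ℤ)⟧' = 0 := by
  rw [← Functor.map_comp, h, Functor.map_zero]

lemma lift_comp_mapBiprod_inv {A B D : C} (a : D ⟶ A⟦(1 : ℤ)⟧) (b : D ⟶ B⟦(1 : ℤ)⟧) :
    biprod.lift a b ≫ ((shiftFunctor C (1 : ℤ)).mapBiprod A B).inv =
      a ≫ biprod.inl⟦(1 : ℤ)⟧' + b ≫ biprod.inr⟦(1 : ℤ)⟧' := by
  rw [Functor.mapBiprod_inv]
  exact biprod.lift_desc ..

/-- A decomposition of the candidate triangle `(f, g, k)` as a direct sum of `(f₁, g₁, k₁)`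
and `(f₂, g₂, k₂)`. -/
structure TriangleSplitting {P Q R P₁ Q₁ R₁ P₂ Q₂ R₂ : C}
    (f : P ⟶ Q) (g : Q ⟶ R) (k : R ⟶ P⟦(1 : ℤ)⟧)
    (f₁ : P₁ ⟶ Q₁) (g₁ : Q₁ ⟶ R₁) (k₁ : R₁ ⟶ P₁⟦(1 : ℤ)⟧)
    (f₂ : P₂ ⟶ Q₂) (g₂ : Q₂ ⟶ R₂) (k₂ : R₂ ⟶ P₂⟦(1 : ℤ)⟧) where
  iP : P₁ ⟶ P
  pP : P ⟶ P₁
  jP : P₂ ⟶ P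
  qP : P ⟶ P₂
  iQ : Q₁ ⟶ Q
  pQ : Q ⟶ Q₁
  jQ : Q₂ ⟶ Q
  qQ : Q ⟶ Q₂
  iR : R₁ ⟶ R
  pR : R ⟶ R₁
  jR : R₂ ⟶ R
  qR : R ⟶ R₂
  i_f : f₁ ≫ iQ = iP ≫ f
  i_g : g₁ ≫ iR = iQ ≫ g
  i_k : k₁ ≫ iP⟦(1 : ℤ)⟧' = iR ≫ k
  j_f : f₂ ≫ jQ = jP ≫ f
  j_g : g₂ ≫ jR = jQ ≫ g
  j_k : k₂ ≫ jP⟦(1 : ℤ)⟧' = jR ≫ k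
  ipP : iP ≫ pP = 𝟙 P₁
  iqP : iP ≫ qP = 0
  jpP : jP ≫ pP = 0
  jqP : jP ≫ qP = 𝟙 P₂
  totalP : pP ≫ iP + qP ≫ jP = 𝟙 P
  ipQ : iQ ≫ pQ = 𝟙 Q₁
  iqQ : iQ ≫ qQ = 0
  jpQ : jQ ≫ pQ = 0
  jqQ : jQ ≫ qQ = 𝟙 Q₂
  totalQ : pQ ≫ iQ + qQ ≫ jQ = 𝟙 Q
  ipR : iR ≫ pR = 𝟙 R₁
  iqR : iR ≫ qR = 0
  jpR : jR ≫ pR = 0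
  jqR : jR ≫ qR = 𝟙 R₂
  totalR : pR ≫ iR + qR ≫ jR = 𝟙 R

namespace TriangleSplitting

/-- The projections of a splitting commute with maps that the injections commute with. -/
lemma proj_comm {P Q P₁ Q₁ P₂ Q₂ : C} {f : P ⟶ Q} {f₁ : P₁ ⟶ Q₁} {f₂ : P₂ ⟶ Q₂}
    {i : P₁ ⟶ P} {p : P ⟶ P₁} {j : P₂ ⟶ P} {q : P ⟶ P₂}
    {i' : Q₁ ⟶ Q} {p' : Q ⟶ Q₁} {j' : Q₂ ⟶ Q}
    (total : p ≫ i + q ≫ j = 𝟙 P) (hi : f₁ ≫ i' = i ≫ f) (hj : f₂ ≫ j' = j ≫ f)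
    (hip : i' ≫ p' = 𝟙 Q₁) (hjp : j' ≫ p' = 0) : f ≫ p' = p ≫ f₁ := by
  rw [← id_comp (f ≫ p'), ← total, Preadditive.add_comp, assoc, assoc, ← reassoc_of% hi,
    ← reassoc_of% hj, hip, hjp, comp_id, comp_zero, comp_zero, add_zero]

variable {P Q R P₁ Q₁ R₁ P₂ Q₂ R₂ : C}
  {f : P ⟶ Q} {g : Q ⟶ R} {k : R ⟶ P⟦(1 : ℤ)⟧}
  {f₁ : P₁ ⟶ Q₁} {g₁ : Q₁ ⟶ R₁} {k₁ : R₁ ⟶ P₁⟦(1 : ℤ)⟧}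
  {f₂ : P₂ ⟶ Q₂} {g₂ : Q₂ ⟶ R₂} {k₂ : R₂ ⟶ P₂⟦(1 : ℤ)⟧}

/-- The binary bicone of triangles given by a splitting. -/
noncomputable def bicone (S : TriangleSplitting f g k f₁ g₁ k₁ f₂ g₂ k₂) :
    BinaryBicone (Triangle.mk f₁ g₁ k₁) (Triangle.mk f₂ g₂ k₂) where
  pt := Triangle.mk f g k
  inl := Triangle.homMk _ _ S.iP S.iQ S.iR S.i_f S.i_g S.i_k
  inr := Triangle.homMk _ _ S.jP S.jQ S.jR S.j_f S.j_g S.j_k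
  fst := Triangle.homMk _ _ S.pP S.pQ S.pR (proj_comm S.totalP S.i_f S.j_f S.ipQ S.jpQ)
    (proj_comm S.totalQ S.i_g S.j_g S.ipR S.jpR)
    (proj_comm S.totalR S.i_k S.j_k
      (shift_map_comp_eq_id S.ipP)
      (shift_map_comp_eq_zero S.jpP))
  snd := Triangle.homMk _ _ S.qP S.qQ S.qR
    (proj_comm ((add_comm _ _).trans S.totalP) S.j_f S.i_f S.jqQ S.iqQ)
    (proj_comm ((add_comm _ _).trans S.totalQ) S.j_g S.i_g S.jqR S.iqR)
    (proj_comm ((add_comm _ _).trans S.totalR) S.j_k S.i_k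
      (shift_map_comp_eq_id S.jqP)
      (shift_map_comp_eq_zero S.iqP))
  inl_fst := Triangle.hom_ext _ _ S.ipP S.ipQ S.ipR
  inl_snd := Triangle.hom_ext _ _ S.iqP S.iqQ S.iqR
  inr_fst := Triangle.hom_ext _ _ S.jpP S.jpQ S.jpR
  inr_snd := Triangle.hom_ext _ _ S.jqP S.jqQ S.jqR

lemma distinguished (S : TriangleSplitting f g k f₁ g₁ k₁ f₂ g₂ k₂)
    (h₁ : Triangle.mk f₁ g₁ k₁ ∈ distTriang C) (h₂ : Triangle.mk f₂ g₂ k₂ ∈ distTriang C) :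
    Triangle.mk f g k ∈ distTriang C :=
  distinguished_of_bicone S.bicone (Triangle.hom_ext _ _ S.totalP S.totalQ S.totalR) h₁ h₂

lemma distinguished_left (S : TriangleSplitting f g k f₁ g₁ k₁ f₂ g₂ k₂)
    (h : Triangle.mk f g k ∈ distTriang C) : Triangle.mk f₁ g₁ k₁ ∈ distTriang C :=
  distinguished_left_of_bicone S.bicone h

end TriangleSplitting

section

variable {X X'' Y Y'' Z Z' : C}

/-- The triangle `X ⊞ X'' ⟶ Y ⊞ Y'' ⟶ Z' ⟶ (X ⊞ X'')⟦1⟧` whose first map is the upper triangular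
matrix with entries `u`, `c` and `u''`. -/
noncomputable abbrev upperTriangle (u : X ⟶ Y) (c : X'' ⟶ Y) (u'' : X'' ⟶ Y'')
    (v₁' : Y ⟶ Z') (v₂' : Y'' ⟶ Z') (w₁' : Z' ⟶ X⟦(1 : ℤ)⟧) (w₂' : Z' ⟶ X''⟦(1 : ℤ)⟧) :
    Triangle C :=
  Triangle.mk (biprod.desc (biprod.lift u 0) (biprod.lift c u''))
    (biprod.desc v₁' v₂')
    (biprod.lift w₁' w₂' ≫ ((shiftFunctor C (1 : ℤ)).mapBiprod X X'').inv)

/-- The relations satisfied by the components of a map of triangles into `upperTriangle`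
whose first two components are the inclusions of the first summands. -/
structure InclRelations (u : X ⟶ Y) (v : Y ⟶ Z) (w : Z ⟶ X⟦(1 : ℤ)⟧)
    (c : X'' ⟶ Y) (u'' : X'' ⟶ Y'') (v₁' : Y ⟶ Z') (v₂' : Y'' ⟶ Z')
    (w₁' : Z' ⟶ X⟦(1 : ℤ)⟧) (w₂' : Z' ⟶ X''⟦(1 : ℤ)⟧) (h : Z ⟶ Z') : Prop where
  v_h : v ≫ h = v₁'
  h_w₁ : h ≫ w₁' = w
  h_w₂ : h ≫ w₂' = 0
  u_v : u ≫ v = 0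
  v_w : v ≫ w = 0
  c_v₁ : c ≫ v₁' + u'' ≫ v₂' = 0
  v₂_w₁ : v₂' ≫ w₁' = 0
  v₂_w₂ : v₂' ≫ w₂' = 0
  w₁_u : w₁' ≫ u⟦(1 : ℤ)⟧' + w₂' ≫ c⟦(1 : ℤ)⟧' = 0
  w₂_u'' : w₂' ≫ u''⟦(1 : ℤ)⟧' = 0

variable {u : X ⟶ Y} {v : Y ⟶ Z} {w : Z ⟶ X⟦(1 : ℤ)⟧} {c : X'' ⟶ Y} {u'' : X'' ⟶ Y''}
  {v₁' : Y ⟶ Z'} {v₂' : Y'' ⟶ Z'} {w₁' : Z' ⟶ X⟦(1 : ℤ)⟧} {w₂' : Z' ⟶ X''⟦(1 : ℤ)⟧} {h : Z ⟶ Z'}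

lemma inclRelations_of_isTriMap (hT : Triangle.mk u v w ∈ distTriang C)
    (hT' : upperTriangle u c u'' v₁' v₂' w₁' w₂' ∈ distTriang C)
    (hmap : IsTriMap (Triangle.mk u v w) (upperTriangle u c u'' v₁' v₂' w₁' w₂')
      biprod.inl biprod.inl h) :
    InclRelations u v w c u'' v₁' v₂' w₁' w₂' h := by
  let w' := biprod.lift w₁' w₂' ≫ ((shiftFunctor C (1 : ℤ)).mapBiprod X X'').inv
  have hm₂ : v ≫ h = biprod.inl ≫ biprod.desc v₁' v₂' := hmap.2.1
  have hm₃ : w ≫ biprod.inl⟦(1 : ℤ)⟧' = h ≫ w' := hmap.2.2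
  have h₁₂ : biprod.desc (biprod.lift u 0) (biprod.lift c u'') ≫ biprod.desc v₁' v₂' = 0 :=
    comp_distTriang_mor_zero₁₂ _ hT'
  have h₂₃ : biprod.desc v₁' v₂' ≫ w' = 0 := comp_distTriang_mor_zero₂₃ _ hT'
  have h₃₁ : w' ≫ (biprod.desc (biprod.lift u 0) (biprod.lift c u''))⟦(1 : ℤ)⟧' = 0 :=
    comp_distTriang_mor_zero₃₁ _ hT'
  have w₁ : w' ≫ biprod.fst⟦(1 : ℤ)⟧' = w₁' := by
    simp only [w', lift_comp_mapBiprod_inv, Preadditive.add_comp, assoc, shift_map_comp_eq_id biprod.inl_fst,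
      shift_map_comp_eq_zero biprod.inr_fst, comp_id, comp_zero, add_zero]
  have w₂ : w' ≫ biprod.snd⟦(1 : ℤ)⟧' = w₂' := by
    simp only [w', lift_comp_mapBiprod_inv, Preadditive.add_comp, assoc, shift_map_comp_eq_zero biprod.inl_snd,
      shift_map_comp_eq_id biprod.inr_snd, comp_id, comp_zero, zero_add]
  clear_value w'
  refine ⟨by simpa using hm₂, ?_, ?_, comp_distTriang_mor_zero₁₂ _ hT,
    comp_distTriang_mor_zero₂₃ _ hT, by simpa using biprod.inr ≫= h₁₂, ?_, ?_, ?_, ?_⟩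
  · rw [← w₁, ← assoc, ← hm₃, assoc, shift_map_comp_eq_id biprod.inl_fst, comp_id]
  · rw [← w₂, ← assoc, ← hm₃, assoc, shift_map_comp_eq_zero biprod.inl_snd, comp_zero]
  · have := biprod.inr ≫= h₂₃ =≫ biprod.fst⟦(1 : ℤ)⟧'
    simpa only [assoc, w₁, biprod.inr_desc_assoc, zero_comp, comp_zero] using this
  · have := biprod.inr ≫= h₂₃ =≫ biprod.snd⟦(1 : ℤ)⟧'
    simpa only [assoc, w₂, biprod.inr_desc_assoc, zero_comp, comp_zero] using this
  · have := h₃₁ =≫ biprod.fst⟦(1 : ℤ)⟧'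
    rw [assoc, ← Functor.map_comp, zero_comp] at this
    rw [← this, ← w₁, ← w₂, assoc, assoc, ← Preadditive.comp_add, ← Functor.map_comp,
      ← Functor.map_comp, ← Functor.map_add]
    congr 2
    ext <;> simp
  · have := h₃₁ =≫ biprod.snd⟦(1 : ℤ)⟧'
    rw [assoc, ← Functor.map_comp, zero_comp] at this
    rw [← this, ← w₂, assoc, ← Functor.map_comp]
    congr 2
    ext <;> simp

/-- The mapping cone of a map of triangles into `upperTriangle` given by inclusions of direct
summands splits as the sum of the triangle on the complementary summands and a rotated
biproduct triangle. -/
noncomputable def InclRelations.mappingConeSplitting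
    (R : InclRelations u v w c u'' v₁' v₂' w₁' w₂' h) :
    TriangleSplitting
      (biprod.desc (biprod.lift (biprod.desc (biprod.lift u 0) (biprod.lift c u'')) 0)
        (biprod.lift biprod.inl (-v)))
      (biprod.desc (biprod.lift (biprod.desc v₁' v₂') 0) (biprod.lift h (-w)))
      (biprod.desc ((w₁' ≫ biprod.inl⟦(1 : ℤ)⟧' + w₂' ≫ biprod.inr⟦(1 : ℤ)⟧') ≫
          biprod.inl⟦(1 : ℤ)⟧')
        (biprod.inl⟦(1 : ℤ)⟧' ≫ biprod.inl⟦(1 : ℤ)⟧' - u⟦(1 : ℤ)⟧' ≫ biprod.inr⟦(1 : ℤ)⟧'))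
      (biprod.lift (c ≫ v) u'') (biprod.desc h v₂') w₂'
      (biprod.snd : X ⊞ Y ⟶ Y) (0 : Y ⟶ X⟦(1 : ℤ)⟧) (-biprod.inl⟦(1 : ℤ)⟧') where
  iP := biprod.inr ≫ biprod.inl - c ≫ biprod.inr
  iQ := biprod.desc biprod.inr (biprod.inr ≫ biprod.inl)
  iR := biprod.inl - w₁' ≫ biprod.inr
  pP := biprod.fst ≫ biprod.snd
  pQ := biprod.desc (biprod.desc (v ≫ biprod.inl) biprod.inr) biprod.inl
  pR := biprod.fst
  jP := biprod.fst ≫ biprod.inl ≫ biprod.inl + (biprod.snd - biprod.fst ≫ u) ≫ biprod.inr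
  jQ := biprod.inl ≫ biprod.inl - v ≫ biprod.inr
  jR := -biprod.inr
  qP := biprod.desc (biprod.desc (biprod.inl + u ≫ biprod.inr) (c ≫ biprod.inr)) biprod.inr
  qQ := biprod.fst ≫ biprod.fst
  qR := -biprod.snd - biprod.fst ≫ w₁'
  i_f := by ext <;> simp
  i_g := by ext <;> simp [R.h_w₁, R.v₂_w₁]
  i_k := by
    have := eq_neg_of_add_eq_zero_left (R.w₁_u)
    simp [Functor.map_sub, Functor.map_comp, reassoc_of% this]
  j_f := by ext <;> simp [R.u_v]
  j_g := by ext <;> simp [R.v_h, R.v_w]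
  j_k := by
    simp only [Functor.map_add, Functor.map_sub, Functor.map_comp, Preadditive.comp_add,
      Preadditive.sub_comp, Preadditive.comp_sub, Preadditive.neg_comp, biprod.inr_desc,
      reassoc_of% shift_map_comp_eq_id (biprod.inl_fst (X := X) (Y := Y)),
      reassoc_of% shift_map_comp_eq_zero (biprod.inl_snd (X := X) (Y := Y)), assoc, zero_comp]
    abel
  ipP := by simp
  iqP := by ext <;> simp
  jpP := by ext <;> simp
  jqP := by ext <;> simp
  totalP := by ext <;> simp
  ipQ := by ext <;> simp
  iqQ := by ext <;> simp
  jpQ := by simp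
  jqQ := by simp
  totalQ := by ext <;> simp
  ipR := by simp
  iqR := by simp
  jpR := by simp
  jqR := by simp
  totalR := by ext <;> simp

end

/-- Two distinguished triangles with the same first map: a compatible map between the third
objects is an isomorphism. -/
lemma isIso_of_distinguished {A B D E : C} {f : A ⟶ B} {g : B ⟶ D} {k : D ⟶ A⟦(1 : ℤ)⟧}
    {g' : B ⟶ E} {k' : E ⟶ A⟦(1 : ℤ)⟧} (h₁ : Triangle.mk f g k ∈ distTriang C)
    (h₂ : Triangle.mk f g' k' ∈ distTriang C) (e : D ⟶ E) (hg : g ≫ e = g')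
    (hk : e ≫ k' = k) : IsIso e := by
  have hk₁ : k ≫ (𝟙 A)⟦(1 : ℤ)⟧' = e ≫ k' := by
    rw [CategoryTheory.Functor.map_id, comp_id, hk]
  let φ : Triangle.mk f g k ⟶ Triangle.mk f g' k' :=
    Triangle.homMk _ _ (𝟙 A) (𝟙 B) e 
      ((comp_id f).trans (id_comp f).symm) (hg.trans (id_comp g').symm) hk₁
  exact isIso₃_of_isIso₁₂ φ h₁ h₂ (inferInstanceAs (IsIso (𝟙 A))) (inferInstanceAs (IsIso (𝟙 B)))

/-- Distinguished triangles are stable under isomorphisms of the three objects. -/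
lemma distinguished_of_isIso {A B D A' B' D' : C} {f : A ⟶ B} {g : B ⟶ D}
    {k : D ⟶ A⟦(1 : ℤ)⟧} {f' : A' ⟶ B'} {g' : B' ⟶ D'} {k' : D' ⟶ A'⟦(1 : ℤ)⟧}
    (hD : Triangle.mk f' g' k' ∈ distTriang C) (a : A ⟶ A') (b : B ⟶ B') (d : D ⟶ D')
    [IsIso a] [IsIso b] [IsIso d] (hf : f ≫ b = a ≫ f') (hg : g ≫ d = b ≫ g')
    (hk : k ≫ a⟦(1 : ℤ)⟧' = d ≫ k') : Triangle.mk f g k ∈ distTriang C :=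
  let e₁ : A ≅ A' := asIso a
  let e₂ : B ≅ B' := asIso b
  let e₃ : D ≅ D' := asIso d
  isomorphic_distinguished _ hD _ (Triangle.isoMk _ _ e₁ e₂ e₃ hf hg hk)

/-- Adding a contractible summand to the second and third objects of a distinguished triangle. -/
lemma biprod_distinguished {X Y Z W : C} {u : X ⟶ Y} {v : Y ⟶ Z} {w : Z ⟶ X⟦(1 : ℤ)⟧}
    (hT : Triangle.mk u v w ∈ distTriang C) :
    Triangle.mk (u ≫ biprod.inl) (biprod.map v (𝟙 W)) (biprod.fst ≫ w) ∈ distTriang C := by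
  refine TriangleSplitting.distinguished
    { iP := 𝟙 X, pP := 𝟙 X, jP := 0, qP := 0
      iQ := biprod.inl, pQ := biprod.fst, jQ := biprod.inr, qQ := biprod.snd
      iR := biprod.inl, pR := biprod.fst, jR := biprod.inr, qR := biprod.snd
      i_f := ?_, i_g := ?_, i_k := ?_, j_f := ?_, j_g := ?_, j_k := ?_
      ipP := ?_, iqP := ?_, jpP := ?_, jqP := ?_, totalP := ?_
      ipQ := ?_, iqQ := ?_, jpQ := ?_, jqQ := ?_, totalQ := ?_
      ipR := ?_, iqR := ?_, jpR := ?_, jqR := ?_, totalR := ?_ }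
    hT (contractible_distinguished₁ W)
  all_goals simp

/-- The direct sum of two distinguished triangles is distinguished. -/
lemma biprod_map_distinguished {X Y Z X' Y' Z' : C} {u : X ⟶ Y} {v : Y ⟶ Z}
    {w : Z ⟶ X⟦(1 : ℤ)⟧} {u' : X' ⟶ Y'} {v' : Y' ⟶ Z'} {w' : Z' ⟶ X'⟦(1 : ℤ)⟧}
    (h₁ : Triangle.mk u v w ∈ distTriang C) (h₂ : Triangle.mk u' v' w' ∈ distTriang C) :
    Triangle.mk (biprod.map u u') (biprod.map v v')
      (biprod.desc (w ≫ biprod.inl⟦(1 : ℤ)⟧') (w' ≫ biprod.inr⟦(1 : ℤ)⟧')) ∈ distTriang C := by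
  refine TriangleSplitting.distinguished
    { iP := biprod.inl, pP := biprod.fst, jP := biprod.inr, qP := biprod.snd
      iQ := biprod.inl, pQ := biprod.fst, jQ := biprod.inr, qQ := biprod.snd
      iR := biprod.inl, pR := biprod.fst, jR := biprod.inr, qR := biprod.snd
      i_f := ?_, i_g := ?_, i_k := ?_, j_f := ?_, j_g := ?_, j_k := ?_
      ipP := ?_, iqP := ?_, jpP := ?_, jqP := ?_, totalP := ?_
      ipQ := ?_, iqQ := ?_, jpQ := ?_, jqQ := ?_, totalQ := ?_
      ipR := ?_, iqR := ?_, jpR := ?_, jqR := ?_, totalR := ?_ } h₁ h₂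
  all_goals simp

lemma isVerdierGood_mk_iff {X Y Z X' Y' Z' : C} {u : X ⟶ Y} {v : Y ⟶ Z} {w : Z ⟶ X⟦(1 : ℤ)⟧}
    {u' : X' ⟶ Y'} {v' : Y' ⟶ Z'} {w' : Z' ⟶ X'⟦(1 : ℤ)⟧}
    {f : X ⟶ X'} {g : Y ⟶ Y'} {h : Z ⟶ Z'} :
    IsVerdierGood (Triangle.mk u v w) (Triangle.mk u' v' w') f g h ↔
      ∃ (A Y'' X'' : C) (vt : Y' ⟶ A) (wt : A ⟶ X⟦(1 : ℤ)⟧)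
        (g' : Y' ⟶ Y'') (g'' : Y'' ⟶ Y⟦(1 : ℤ)⟧) (f' : X' ⟶ X'') (f'' : X'' ⟶ X⟦(1 : ℤ)⟧)
        (α₁ : Z ⟶ A) (β₁ : A ⟶ Y'') (α₂ : X'' ⟶ A) (β₂ : A ⟶ Z'),
        (Triangle.mk (u ≫ g) vt wt ∈ distTriang C) ∧ (Triangle.mk g g' g'' ∈ distTriang C) ∧
        (Triangle.mk f f' f'' ∈ distTriang C) ∧
        IsOctahedron u g v w g' g'' vt wt α₁ β₁ ∧
        IsOctahedron f u' f' f'' v' w' vt wt α₂ β₂ ∧ h = α₁ ≫ β₂ :=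
  Iff.rfl

section

variable {X X'' Y Y'' Z Z' : C}
  {u : X ⟶ Y} {v : Y ⟶ Z} {w : Z ⟶ X⟦(1 : ℤ)⟧} {c : X'' ⟶ Y} {u'' : X'' ⟶ Y''}
  {v₁' : Y ⟶ Z'} {v₂' : Y'' ⟶ Z'} {w₁' : Z' ⟶ X⟦(1 : ℤ)⟧} {w₂' : Z' ⟶ X''⟦(1 : ℤ)⟧} {h : Z ⟶ Z'}

lemma InclRelations.isGood_iff (R : InclRelations u v w c u'' v₁' v₂' w₁' w₂' h) :
    IsGood (Triangle.mk u v w) (upperTriangle u c u'' v₁' v₂' w₁' w₂')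
      biprod.inl biprod.inl h ↔
    Triangle.mk (biprod.lift (c ≫ v) u'') (biprod.desc h v₂') w₂' ∈ distTriang C := by
  have hk : biprod.desc (biprod.lift (biprod.lift w₁' w₂' ≫
        ((shiftFunctor C (1 : ℤ)).mapBiprod X X'').inv) 0)
      (biprod.lift (biprod.inl⟦(1 : ℤ)⟧') (-u⟦(1 : ℤ)⟧')) ≫
        ((shiftFunctor C (1 : ℤ)).mapBiprod (X ⊞ X'') Y).inv =
      biprod.desc ((w₁' ≫ biprod.inl⟦(1 : ℤ)⟧' + w₂' ≫ biprod.inr⟦(1 : ℤ)⟧') ≫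
          biprod.inl⟦(1 : ℤ)⟧')
        (biprod.inl⟦(1 : ℤ)⟧' ≫ biprod.inl⟦(1 : ℤ)⟧' - u⟦(1 : ℤ)⟧' ≫ biprod.inr⟦(1 : ℤ)⟧') := by
    apply biprod.hom_ext'
    · rw [biprod.inl_desc_assoc, biprod.inl_desc, lift_comp_mapBiprod_inv,
        lift_comp_mapBiprod_inv, zero_comp, add_zero]
    · rw [biprod.inr_desc_assoc, biprod.inr_desc, lift_comp_mapBiprod_inv,
        Preadditive.neg_comp, sub_eq_add_neg]
  have S := R.mappingConeSplitting
  rw [← hk] at S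
  exact ⟨S.distinguished_left, fun h₁ => S.distinguished h₁
    (rot_of_distTriang _ (binaryBiproductTriangle_distinguished X Y))⟩

lemma InclRelations.distinguished_of_eq_zero (R : InclRelations u v w c u'' v₁' v₂' w₁' w₂' h)
    (hT : Triangle.mk u v w ∈ distTriang C)
    (hT' : upperTriangle u c u'' v₁' v₂' w₁' w₂' ∈ distTriang C) (hc : c = 0) :
    Triangle.mk (biprod.lift (c ≫ v) u'') (biprod.desc h v₂') w₂' ∈ distTriang C := by
  subst hc
  obtain ⟨Z'', v'', w'', hT''⟩ := distinguished_cocone_triangle u''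
  rw [upperTriangle, lift_comp_mapBiprod_inv] at hT'
  have h₀ : u'' ≫ biprod.inr = biprod.inr ≫ biprod.desc (biprod.lift u 0) (biprod.lift 0 u'') := by
    ext <;> simp
  obtain ⟨φ, hφ₂, hφ₃⟩ : ∃ φ : Z'' ⟶ Z', v'' ≫ φ = biprod.inr ≫ biprod.desc v₁' v₂' ∧
      w'' ≫ biprod.inr⟦(1 : ℤ)⟧' =
        φ ≫ (w₁' ≫ biprod.inl⟦(1 : ℤ)⟧' + w₂' ≫ biprod.inr⟦(1 : ℤ)⟧') :=
    complete_distinguished_triangle_morphism _ _ hT'' hT' biprod.inr biprod.inr h₀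
  have hφw₂ : φ ≫ w₂' = w'' := by
    have := hφ₃ =≫ biprod.snd⟦(1 : ℤ)⟧'
    simpa [shift_map_comp_eq_id biprod.inr_snd, shift_map_comp_eq_zero biprod.inl_snd] using this.symm
  have hM : biprod.desc (biprod.lift u 0) (biprod.lift 0 u'') = biprod.map u u'' := by
    ext <;> simp
  rw [hM] at hT'
  have : IsIso (biprod.desc h φ) := by
    refine isIso_of_distinguished (biprod_map_distinguished hT hT'') hT' _ ?_ ?_
    · ext <;> simp [R.v_h, hφ₂]
    · ext <;> simp [reassoc_of% R.h_w₁, reassoc_of% R.h_w₂, hφ₃]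
  have h₁ : h ≫ inv (biprod.desc h φ) = biprod.inl := by
    rw [IsIso.comp_inv_eq, biprod.inl_desc]
  have h₂ : φ ≫ inv (biprod.desc h φ) = biprod.inr := by
    rw [IsIso.comp_inv_eq, biprod.inr_desc]
  refine TriangleSplitting.distinguished
    { iP := 0, pP := 0, jP := 𝟙 X'', qP := 𝟙 X''
      iQ := biprod.inl, pQ := biprod.fst, jQ := biprod.inr, qQ := biprod.snd
      iR := h, pR := inv (biprod.desc h φ) ≫ biprod.fst
      jR := φ, qR := inv (biprod.desc h φ) ≫ biprod.snd
      i_f := ?_, i_g := ?_, i_k := ?_, j_f := ?_, j_g := ?_, j_k := ?_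
      ipP := ?_, iqP := ?_, jpP := ?_, jqP := ?_, totalP := ?_
      ipQ := ?_, iqQ := ?_, jpQ := ?_, jqQ := ?_, totalQ := ?_
      ipR := ?_, iqR := ?_, jpR := ?_, jqR := ?_, totalR := ?_ }
    (contractible_distinguished₁ Z) hT''
  case refine_4 => ext <;> simp
  case refine_21 =>
    rw [assoc, assoc, ← Preadditive.comp_add, ← biprod.desc_eq, IsIso.inv_hom_id]
  all_goals simp [R.h_w₂, hφ₂, hφw₂, reassoc_of% h₁, reassoc_of% h₂]

lemma InclRelations.isVerdierGood (R : InclRelations u v w c u'' v₁' v₂' w₁' w₂' h)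
    (hT : Triangle.mk u v w ∈ distTriang C)
    (hc : Triangle.mk (biprod.lift (c ≫ v) u'') (biprod.desc h v₂') w₂' ∈ distTriang C) :
    IsVerdierGood (Triangle.mk u v w) (upperTriangle u c u'' v₁' v₂' w₁' w₂')
      biprod.inl biprod.inl h := by
  have hw : (biprod.lift w₁' w₂' ≫ ((shiftFunctor C (1 : ℤ)).mapBiprod X X'').inv) ≫
      biprod.snd⟦(1 : ℤ)⟧' = w₂' := by
    simp only [lift_comp_mapBiprod_inv, Preadditive.add_comp, assoc,
      shift_map_comp_eq_zero biprod.inl_snd, shift_map_comp_eq_id biprod.inr_snd, comp_id,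
      comp_zero, zero_add]
  have o₁ : IsOctahedron u (biprod.inl : Y ⟶ Y ⊞ Y'') v w biprod.snd 0 (biprod.map v (𝟙 Y''))
      (biprod.fst ≫ w) biprod.inl biprod.snd := by
    refine ⟨?_, ?_, ?_, ?_, ?_⟩
    · simp
    · simp
    · simp
    · have : w ≫ u⟦(1 : ℤ)⟧' = 0 := comp_distTriang_mor_zero₃₁ _ hT
      simp [this]
    · rw [zero_comp]
      exact binaryBiproductTriangle_distinguished Z Y''
  have o₂ : IsOctahedron (biprod.inl : X ⟶ X ⊞ X'')
      (biprod.desc (biprod.lift u 0) (biprod.lift c u'')) biprod.snd 0 (biprod.desc v₁' v₂')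
      (biprod.lift w₁' w₂' ≫ ((shiftFunctor C (1 : ℤ)).mapBiprod X X'').inv)
      (biprod.map v (𝟙 Y'')) (biprod.fst ≫ w) (biprod.lift (c ≫ v) u'') (biprod.desc h v₂') := by
    refine ⟨?_, ?_, ?_, ?_, ?_⟩
    · ext <;> simp [R.u_v]
    · simp [R.v_w]
    · ext <;> simp [R.v_h]
    · rw [lift_comp_mapBiprod_inv]
      ext <;> simp [reassoc_of% R.h_w₁, reassoc_of% R.h_w₂, reassoc_of% R.v₂_w₁,
        reassoc_of% R.v₂_w₂]
    · rw [hw]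
      exact hc
  have hA : Triangle.mk (u ≫ biprod.inl) (biprod.map v (𝟙 Y'')) (biprod.fst ≫ w) ∈ distTriang C :=
    biprod_distinguished hT
  exact isVerdierGood_mk_iff.2 ⟨_, _, _, _, _, _, _, _, _, _, _, _, _, hA,
    binaryBiproductTriangle_distinguished Y Y'', binaryBiproductTriangle_distinguished X X'',
    o₁, o₂, (biprod.inl_desc _ _).symm⟩

lemma distinguished_of_isVerdierGood_incl
    (hT : Triangle.mk u v w ∈ distTriang C)
    (hV : IsVerdierGood (Triangle.mk u v w) (upperTriangle u c u'' v₁' v₂' w₁' w₂')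
      biprod.inl biprod.inl h) :
    Triangle.mk (biprod.lift (c ≫ v) u'') (biprod.desc h v₂') w₂' ∈ distTriang C := by
  obtain ⟨A, Y₁, X₁, vt, wt, g', g'', f', f'', α₁, β₁, α₂, β₂, hA, hg, hf,
    ⟨a₁, a₂, -, -, -⟩, ⟨b₁, -, b₃, -, b₅⟩, hh⟩ := isVerdierGood_mk_iff.1 hV
  rw [lift_comp_mapBiprod_inv] at b₅
  replace a₁ : v ≫ α₁ = biprod.inl ≫ vt := a₁
  have hf₀ : biprod.inl ≫ f' = 0 := comp_distTriang_mor_zero₁₂ _ hf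
  have hf₁ : f' ≫ f'' = 0 := comp_distTriang_mor_zero₂₃ _ hf
  have hvw : vt ≫ wt = 0 := comp_distTriang_mor_zero₂₃ _ hA
  have : IsIso (biprod.desc α₁ (biprod.inr ≫ vt)) := by
    refine isIso_of_distinguished (biprod_distinguished hT) hA _ ?_ ?_
    · ext <;> simp [a₁]
    · ext <;> simp [a₂, hvw]
  have hf₂ : biprod.snd ≫ biprod.inr ≫ f' = f' := by
    ext <;> simp [hf₀]
  have : IsIso (biprod.inr ≫ f') := by
    refine isIso_of_distinguished (binaryBiproductTriangle_distinguished X X'') hf _ hf₂ ?_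
    simp [hf₁]
  refine distinguished_of_isIso b₅ (biprod.inr ≫ f') (biprod.desc α₁ (biprod.inr ≫ vt)) (𝟙 Z')
    ?_ ?_ ?_
  · rw [assoc, b₁]
    simp [a₁, biprod.lift_eq]
  · ext <;> simp [hh, b₃]
  · rw [Preadditive.add_comp, assoc, assoc, shift_map_comp_eq_zero hf₀, comp_zero, zero_add,
      id_comp, Functor.map_comp]

end

theorem stmt_4 {X X'' Y Y'' Z Z' : C}
    (u : X ⟶ Y) (v : Y ⟶ Z) (w : Z ⟶ X⟦(1 : ℤ)⟧)
    (c : X'' ⟶ Y) (u'' : X'' ⟶ Y'')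
    (v₁' : Y ⟶ Z') (v₂' : Y'' ⟶ Z')
    (w₁' : Z' ⟶ X⟦(1 : ℤ)⟧) (w₂' : Z' ⟶ X''⟦(1 : ℤ)⟧)
    (hT : Triangle.mk u v w ∈ distTriang C)
    (hT' : (Triangle.mk (biprod.desc (biprod.lift u 0) (biprod.lift c u''))
      (biprod.desc v₁' v₂')
      (biprod.lift w₁' w₂' ≫ ((shiftFunctor C (1 : ℤ)).mapBiprod X X'').inv)) ∈ distTriang C)
    (h : Z ⟶ Z')
    (hmap : IsTriMap (Triangle.mk u v w) (Triangle.mk (biprod.desc (biprod.lift u 0) (biprod.lift c u''))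
      (biprod.desc v₁' v₂')
      (biprod.lift w₁' w₂' ≫ ((shiftFunctor C (1 : ℤ)).mapBiprod X X'').inv)) biprod.inl biprod.inl h) :
    (IsGood (Triangle.mk u v w) (Triangle.mk (biprod.desc (biprod.lift u 0) (biprod.lift c u''))
      (biprod.desc v₁' v₂')
      (biprod.lift w₁' w₂' ≫ ((shiftFunctor C (1 : ℤ)).mapBiprod X X'').inv)) biprod.inl biprod.inl h ↔
      IsVerdierGood (Triangle.mk u v w) (Triangle.mk (biprod.desc (biprod.lift u 0) (biprod.lift c u''))
      (biprod.desc v₁' v₂')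
      (biprod.lift w₁' w₂' ≫ ((shiftFunctor C (1 : ℤ)).mapBiprod X X'').inv)) biprod.inl biprod.inl h) ∧
    (IsGood (Triangle.mk u v w) (Triangle.mk (biprod.desc (biprod.lift u 0) (biprod.lift c u''))
      (biprod.desc v₁' v₂')
      (biprod.lift w₁' w₂' ≫ ((shiftFunctor C (1 : ℤ)).mapBiprod X X'').inv)) biprod.inl biprod.inl h ↔
      (Triangle.mk (biprod.lift (c ≫ v) u'') (biprod.desc h v₂') w₂' ∈ distTriang C)) ∧
    (c = 0 → IsGood (Triangle.mk u v w) (Triangle.mk (biprod.desc (biprod.lift u 0) (biprod.lift c u''))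
      (biprod.desc v₁' v₂')
      (biprod.lift w₁' w₂' ≫ ((shiftFunctor C (1 : ℤ)).mapBiprod X X'').inv)) biprod.inl biprod.inl h) := by
  have R : InclRelations u v w c u'' v₁' v₂' w₁' w₂' h := inclRelations_of_isTriMap hT hT' hmap
  exact ⟨⟨fun hG => R.isVerdierGood hT (R.isGood_iff.1 hG),
      fun hV => R.isGood_iff.2 (distinguished_of_isVerdierGood_incl hT hV)⟩,
    R.isGood_iff, fun hc => R.isGood_iff.2 (R.distinguished_of_eq_zero hT hT' hc)⟩
end

section
/- Every map of triangles (f,g,h) between distinguished triangles in T factors as a composite of two maps of triangles each of which is both good and Verdier good: there exist a distinguished triangle and maps of triangles (f₁,g₁,h₁) from the source triangle to it and (f₂,g₂,h₂) from it to the target triangle, both of which are good and Verdier good, with f = f₂∘f₁, g = g₂∘g₁, and h = h₂∘h₁. -/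
open CategoryTheory Category Limits Pretriangulated

universe v u

variable {C : Type u} [Category.{v} C] [Preadditive C] [HasZeroObject C]
  [HasShift C ℤ] [∀ n : ℤ, (shiftFunctor C n).Additive] [Pretriangulated C]
  [IsTriangulated C] [HasBinaryBiproducts C]

set_option linter.unusedSectionVars false
open ZeroObject

lemma dist_of_biprod_hom {P T T' : Triangle C} (hT : T ∈ distTriang C) (hT' : T' ∈ distTriang C)
    (p : P ⟶ T) (q : P ⟶ T') (i : T ⟶ P) (j : T' ⟶ P)
    (hip : i ≫ p = 𝟙 T) (hjq : j ≫ q = 𝟙 T') (hs : p ≫ i + q ≫ j = 𝟙 P) :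
    P ∈ distTriang C := by
  have hiq : i ≫ q = 0 := by
    have : i ≫ (p ≫ i + q ≫ j) ≫ q = i ≫ q := by rw [hs, id_comp]
    simp only [Preadditive.add_comp, Preadditive.comp_add, assoc, hjq, comp_id,
      reassoc_of% hip] at this
    simpa using this
  have hjp : j ≫ p = 0 := by
    have : j ≫ (p ≫ i + q ≫ j) ≫ p = j ≫ p := by rw [hs, id_comp]
    simp only [Preadditive.add_comp, Preadditive.comp_add, assoc, hip, comp_id,
      reassoc_of% hjq] at this
    simpa using this
  let F : WalkingPair → Triangle C := fun k => WalkingPair.casesOn k T T'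
  have hF : productTriangle F ∈ distTriang C :=
    productTriangle_distinguished F (by rintro (_ | _) <;> assumption)
  let s : ∀ k, P ⟶ F k := fun k => WalkingPair.casesOn k p q
  have hl := productTriangle.isLimitFan F
  let l : P ⟶ productTriangle F := productTriangle.lift F s
  have hl₁ : l ≫ productTriangle.π F .left = p := by ext <;> exact Pi.lift_π _ _
  have hl₂ : l ≫ productTriangle.π F .right = q := by ext <;> exact Pi.lift_π _ _
  refine isomorphic_distinguished _ hF _
    ⟨l, productTriangle.π F .left ≫ i + productTriangle.π F .right ≫ j, ?_, ?_⟩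
  · rw [Preadditive.comp_add, reassoc_of% hl₁, reassoc_of% hl₂, hs]
  · refine Fan.IsLimit.hom_ext hl _ _ ?_
    rintro (_ | _)
    · change (_ ≫ l) ≫ productTriangle.π F .left = _ ≫ productTriangle.π F .left
      rw [assoc, hl₁, Preadditive.add_comp, assoc, assoc, hip, hjp, comp_zero, add_zero, id_comp]
      exact comp_id _
    · change (_ ≫ l) ≫ productTriangle.π F .right = _ ≫ productTriangle.π F .right
      rw [assoc, hl₂, Preadditive.add_comp, assoc, assoc, hiq, hjq, comp_zero, zero_add, id_comp]
      exact comp_id _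

/-- A triangle which is the direct sum of two distinguished triangles is distinguished. -/
lemma dist_of_biprod {P₁ P₂ P₃ X Y Z X' Y' Z' : C}
    {a : P₁ ⟶ P₂} {b : P₂ ⟶ P₃} {c : P₃ ⟶ P₁⟦(1 : ℤ)⟧}
    {u : X ⟶ Y} {v : Y ⟶ Z} {w : Z ⟶ X⟦(1 : ℤ)⟧}
    {u' : X' ⟶ Y'} {v' : Y' ⟶ Z'} {w' : Z' ⟶ X'⟦(1 : ℤ)⟧}
    (hT : Triangle.mk u v w ∈ distTriang C) (hT' : Triangle.mk u' v' w' ∈ distTriang C)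
    (p₁ : P₁ ⟶ X) (p₂ : P₂ ⟶ Y) (p₃ : P₃ ⟶ Z)
    (q₁ : P₁ ⟶ X') (q₂ : P₂ ⟶ Y') (q₃ : P₃ ⟶ Z')
    (i₁ : X ⟶ P₁) (i₂ : Y ⟶ P₂) (i₃ : Z ⟶ P₃)
    (j₁ : X' ⟶ P₁) (j₂ : Y' ⟶ P₂) (j₃ : Z' ⟶ P₃)
    (pa : a ≫ p₂ = p₁ ≫ u) (pb : b ≫ p₃ = p₂ ≫ v) (pc : c ≫ p₁⟦(1 : ℤ)⟧' = p₃ ≫ w)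
    (qa : a ≫ q₂ = q₁ ≫ u') (qb : b ≫ q₃ = q₂ ≫ v') (qc : c ≫ q₁⟦(1 : ℤ)⟧' = q₃ ≫ w')
    (ia : u ≫ i₂ = i₁ ≫ a) (ib : v ≫ i₃ = i₂ ≫ b) (ic : w ≫ i₁⟦(1 : ℤ)⟧' = i₃ ≫ c)
    (ja : u' ≫ j₂ = j₁ ≫ a) (jb : v' ≫ j₃ = j₂ ≫ b) (jc : w' ≫ j₁⟦(1 : ℤ)⟧' = j₃ ≫ c)
    (ip₁ : i₁ ≫ p₁ = 𝟙 X) (ip₂ : i₂ ≫ p₂ = 𝟙 Y) (ip₃ : i₃ ≫ p₃ = 𝟙 Z)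
    (jq₁ : j₁ ≫ q₁ = 𝟙 X') (jq₂ : j₂ ≫ q₂ = 𝟙 Y') (jq₃ : j₃ ≫ q₃ = 𝟙 Z')
    (s₁ : p₁ ≫ i₁ + q₁ ≫ j₁ = 𝟙 P₁) (s₂ : p₂ ≫ i₂ + q₂ ≫ j₂ = 𝟙 P₂)
    (s₃ : p₃ ≫ i₃ + q₃ ≫ j₃ = 𝟙 P₃) :
    Triangle.mk a b c ∈ distTriang C :=
  dist_of_biprod_hom hT hT'
    (Triangle.homMk (Triangle.mk a b c) (Triangle.mk u v w) p₁ p₂ p₃ pa pb pc)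
    (Triangle.homMk (Triangle.mk a b c) (Triangle.mk u' v' w') q₁ q₂ q₃ qa qb qc)
    (Triangle.homMk (Triangle.mk u v w) (Triangle.mk a b c) i₁ i₂ i₃ ia ib ic)
    (Triangle.homMk (Triangle.mk u' v' w') (Triangle.mk a b c) j₁ j₂ j₃ ja jb jc)
    (by ext <;> assumption) (by ext <;> assumption) (by ext <;> assumption)

lemma biprod_snd_shift_inl_distinguished (X X' : C) :
    Triangle.mk (biprod.snd : X ⊞ X' ⟶ X') 0 ((biprod.inl : X ⟶ X ⊞ X')⟦(1 : ℤ)⟧')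
      ∈ distTriang C := by
  refine dist_of_biprod (contractible_distinguished₂ X) (contractible_distinguished X')
    biprod.fst 0 (𝟙 _) biprod.snd (𝟙 _) 0 biprod.inl 0 (𝟙 _) biprod.inr (𝟙 _) 0
    ?_ ?_ ?_ ?_ ?_ ?_ ?_ ?_ ?_ ?_ ?_ ?_ ?_ ?_ ?_ ?_ ?_ ?_ ?_ ?_ ?_ <;>
    first | exact (isZero_zero C).eq_of_src _ _ | simp [← Functor.map_comp]

lemma lift_desc_neg_distinguished {X X' : C} (f : X ⟶ X') :
    Triangle.mk (biprod.lift (𝟙 X) f) (biprod.desc (-f) (𝟙 X')) 0 ∈ distTriang C := by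
  refine dist_of_biprod (contractible_distinguished X) (contractible_distinguished₁ X')
    (𝟙 _) biprod.fst 0 0 (biprod.desc (-f) (𝟙 X')) (𝟙 _) (𝟙 _) (biprod.lift (𝟙 X) f) 0
    0 biprod.inr (𝟙 _)
    ?_ ?_ ?_ ?_ ?_ ?_ ?_ ?_ ?_ ?_ ?_ ?_ ?_ ?_ ?_ ?_ ?_ ?_ ?_ ?_ ?_ <;>
    try exact (isZero_zero C).eq_of_src _ _
  all_goals try solve | simp
  ext <;> simp

/-- The direct sum of two triangles. -/
noncomputable abbrev biprodTriangle (T T' : Triangle C) : Triangle C :=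
  Triangle.mk (biprod.map T.mor₁ T'.mor₁) (biprod.map T.mor₂ T'.mor₂)
    (biprod.desc (T.mor₃ ≫ biprod.inl⟦(1 : ℤ)⟧') (T'.mor₃ ≫ biprod.inr⟦(1 : ℤ)⟧'))

lemma biprodTriangle_distinguished {T T' : Triangle C}
    (hT : T ∈ distTriang C) (hT' : T' ∈ distTriang C) :
    biprodTriangle T T' ∈ distTriang C := by
  refine dist_of_biprod hT hT' biprod.fst biprod.fst biprod.fst biprod.snd biprod.snd biprod.snd
    biprod.inl biprod.inl biprod.inl biprod.inr biprod.inr biprod.inr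
    ?_ ?_ ?_ ?_ ?_ ?_ ?_ ?_ ?_ ?_ ?_ ?_ ?_ ?_ ?_ ?_ ?_ ?_ ?_ ?_ ?_
  all_goals try solve | simp
  all_goals ext <;> simp [← Functor.map_comp]

lemma mappingCone_eq (T T' : Triangle C) (f : T.obj₁ ⟶ T'.obj₁)
    (g : T.obj₂ ⟶ T'.obj₂) (h : T.obj₃ ⟶ T'.obj₃) :
    mappingCone T T' f g h =
      Triangle.mk
        (biprod.desc (biprod.lift T'.mor₁ 0) (biprod.lift g (-T.mor₂)))
        (biprod.desc (biprod.lift T'.mor₂ 0) (biprod.lift h (-T.mor₃)))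
        (biprod.desc (T'.mor₃ ≫ biprod.inl⟦(1 : ℤ)⟧')
          ((f ≫ biprod.inl - T.mor₁ ≫ biprod.inr : T.obj₁ ⟶ T'.obj₁ ⊞ T.obj₂)⟦(1 : ℤ)⟧')) := by
  unfold mappingCone
  congr 1
  rw [Functor.mapBiprod_inv]
  ext <;> simp [sub_eq_add_neg, Functor.map_add, Functor.map_neg]

lemma mappingCone_id_distinguished {T : Triangle C} (hT : T ∈ distTriang C) :
    mappingCone T T (𝟙 _) (𝟙 _) (𝟙 _) ∈ distTriang C := by
  have h₁₂ := comp_distTriang_mor_zero₁₂ T hT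
  have h₂₃ := comp_distTriang_mor_zero₂₃ T hT
  have h₃₁ := comp_distTriang_mor_zero₃₁ T hT
  rw [mappingCone_eq]
  refine dist_of_biprod (contractible_distinguished₂ T.obj₁)
    (binaryBiproductTriangle_distinguished T.obj₂ T.obj₃)
    biprod.fst 0 (biprod.desc T.mor₃ (𝟙 _))
    (biprod.desc T.mor₁ (𝟙 _)) (biprod.desc (biprod.lift (𝟙 _) T.mor₂) biprod.inr) biprod.fst
    (biprod.inl - T.mor₁ ≫ biprod.inr) 0 biprod.inr
    biprod.inr (biprod.desc (biprod.lift (𝟙 _) (-T.mor₂)) biprod.inr)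
    (biprod.lift (𝟙 _) (-T.mor₃))
    ?_ ?_ ?_ ?_ ?_ ?_ ?_ ?_ ?_ ?_ ?_ ?_ ?_ ?_ ?_ ?_ ?_ ?_ ?_ ?_ ?_
  all_goals try exact (isZero_zero C).eq_of_src _ _
  all_goals try solve | simp
  all_goals try ext
  all_goals first
    | solve | simp [h₁₂, h₂₃, h₃₁, ← Functor.map_comp]
    | simp [reassoc_of% h₃₁]

section constructors

variable {X Y Z X' Y' Z' : C} {u : X ⟶ Y} {v : Y ⟶ Z} {w : Z ⟶ X⟦(1 : ℤ)⟧}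
  {u' : X' ⟶ Y'} {v' : Y' ⟶ Z'} {w' : Z' ⟶ X'⟦(1 : ℤ)⟧}
  {f : X ⟶ X'} {g : Y ⟶ Y'} {h : Z ⟶ Z'}

lemma isTriMap_mk (h₁ : u ≫ g = f ≫ u') (h₂ : v ≫ h = g ≫ v')
    (h₃ : w ≫ f⟦(1 : ℤ)⟧' = h ≫ w') :
    IsTriMap (Triangle.mk u v w) (Triangle.mk u' v' w') f g h :=
  ⟨h₁, h₂, h₃⟩

lemma isGood_mk
    (H : Triangle.mk (biprod.desc (biprod.lift u' 0) (biprod.lift g (-v)))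
      (biprod.desc (biprod.lift v' 0) (biprod.lift h (-w)))
      (biprod.desc (w' ≫ biprod.inl⟦(1 : ℤ)⟧')
        ((f ≫ biprod.inl - u ≫ biprod.inr : X ⟶ X' ⊞ Y)⟦(1 : ℤ)⟧')) ∈ distTriang C) :
    IsGood (Triangle.mk u v w) (Triangle.mk u' v' w') f g h :=
  (congrArg (fun S => S ∈ distTriang C)
    (mappingCone_eq (Triangle.mk u v w) (Triangle.mk u' v' w') f g h)).mpr H

lemma isVerdierGood_mk {A Y'' X'' : C} {vt : Y' ⟶ A} {wt : A ⟶ X⟦(1 : ℤ)⟧}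
    {g' : Y' ⟶ Y''} {g'' : Y'' ⟶ Y⟦(1 : ℤ)⟧} {f' : X' ⟶ X''} {f'' : X'' ⟶ X⟦(1 : ℤ)⟧}
    {α₁ : Z ⟶ A} {β₁ : A ⟶ Y''} {α₂ : X'' ⟶ A} {β₂ : A ⟶ Z'}
    (hA : Triangle.mk (u ≫ g) vt wt ∈ distTriang C)
    (hg : Triangle.mk g g' g'' ∈ distTriang C) (hf : Triangle.mk f f' f'' ∈ distTriang C)
    (h₁ : IsOctahedron u g v w g' g'' vt wt α₁ β₁)
    (h₂ : IsOctahedron f u' f' f'' v' w' vt wt α₂ β₂) (hh : h = α₁ ≫ β₂) :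
    IsVerdierGood (Triangle.mk u v w) (Triangle.mk u' v' w') f g h :=
  ⟨A, Y'', X'', vt, wt, g', g'', f', f'', α₁, β₁, α₂, β₂, hA, hg, hf, h₁, h₂, hh⟩

end constructors

section

variable {T T' : Triangle C} {f : T.obj₁ ⟶ T'.obj₁} {g : T.obj₂ ⟶ T'.obj₂}
  {h : T.obj₃ ⟶ T'.obj₃}

lemma isTriMap_lift (hmap : IsTriMap T T' f g h) :
    IsTriMap T (biprodTriangle T T') (biprod.lift (𝟙 _) f) (biprod.lift (𝟙 _) g)
      (biprod.lift (𝟙 _) h) := by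
  obtain ⟨h₁, h₂, h₃⟩ := hmap
  refine isTriMap_mk (u := T.mor₁) (v := T.mor₂) (w := T.mor₃)
    (u' := biprod.map T.mor₁ T'.mor₁) (v' := biprod.map T.mor₂ T'.mor₂)
    (w' := biprod.desc (T.mor₃ ≫ biprod.inl⟦(1 : ℤ)⟧') (T'.mor₃ ≫ biprod.inr⟦(1 : ℤ)⟧'))
    (f := biprod.lift (𝟙 T.obj₁) f) (g := biprod.lift (𝟙 T.obj₂) g)
    (h := biprod.lift (𝟙 T.obj₃) h) ?_ ?_ ?_
  · ext <;> simp [h₁]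
  · ext <;> simp [h₂]
  · simp [biprod.lift_eq, reassoc_of% h₃]

lemma isTriMap_snd (T T' : Triangle C) :
    IsTriMap (biprodTriangle T T') T' biprod.snd biprod.snd biprod.snd := by
  refine isTriMap_mk (u := biprod.map T.mor₁ T'.mor₁) (v := biprod.map T.mor₂ T'.mor₂)
    (w := biprod.desc (T.mor₃ ≫ biprod.inl⟦(1 : ℤ)⟧') (T'.mor₃ ≫ biprod.inr⟦(1 : ℤ)⟧'))
    (u' := T'.mor₁) (v' := T'.mor₂) (w' := T'.mor₃)
    (f := biprod.snd) (g := biprod.snd) (h := biprod.snd) ?_ ?_ ?_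
  · simp
  · simp
  · ext <;> simp [← Functor.map_comp]

lemma isGood_lift (hT : T ∈ distTriang C) (hT' : T' ∈ distTriang C)
    (hmap : IsTriMap T T' f g h) :
    IsGood T (biprodTriangle T T') (biprod.lift (𝟙 _) f) (biprod.lift (𝟙 _) g)
      (biprod.lift (𝟙 _) h) := by
  obtain ⟨h₁, h₂, h₃⟩ := hmap
  have hid := mappingCone_id_distinguished hT
  rw [mappingCone_eq] at hid
  refine isGood_mk (u := T.mor₁) (v := T.mor₂) (w := T.mor₃)
    (u' := biprod.map T.mor₁ T'.mor₁) (v' := biprod.map T.mor₂ T'.mor₂)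
    (w' := biprod.desc (T.mor₃ ≫ biprod.inl⟦(1 : ℤ)⟧') (T'.mor₃ ≫ biprod.inr⟦(1 : ℤ)⟧'))
    (f := biprod.lift (𝟙 T.obj₁) f) (g := biprod.lift (𝟙 T.obj₂) g)
    (h := biprod.lift (𝟙 T.obj₃) h) ?_
  refine dist_of_biprod hid hT'
    (biprod.desc (biprod.fst ≫ biprod.inl) biprod.inr)
    (biprod.desc (biprod.fst ≫ biprod.inl) biprod.inr)
    (biprod.desc (biprod.fst ≫ biprod.inl) biprod.inr)
    (biprod.fst ≫ biprod.desc (-f) (𝟙 _)) (biprod.fst ≫ biprod.desc (-g) (𝟙 _))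
    (biprod.fst ≫ biprod.desc (-h) (𝟙 _))
    (biprod.desc (biprod.lift (𝟙 _) f ≫ biprod.inl) biprod.inr)
    (biprod.desc (biprod.lift (𝟙 _) g ≫ biprod.inl) biprod.inr)
    (biprod.desc (biprod.lift (𝟙 _) h ≫ biprod.inl) biprod.inr)
    (biprod.inr ≫ biprod.inl) (biprod.inr ≫ biprod.inl) (biprod.inr ≫ biprod.inl)
    ?_ ?_ ?_ ?_ ?_ ?_ ?_ ?_ ?_ ?_ ?_ ?_ ?_ ?_ ?_ ?_ ?_ ?_ ?_ ?_ ?_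
  all_goals try ext
  all_goals simp [h₁, h₂, h₃, biprod.lift_eq, ← Functor.map_comp, ← reassoc_of% h₃]

lemma isGood_snd (hT : T ∈ distTriang C) (hT' : T' ∈ distTriang C) :
    IsGood (biprodTriangle T T') T' biprod.snd biprod.snd biprod.snd := by
  have hid := mappingCone_id_distinguished hT'
  rw [mappingCone_eq] at hid
  have hT₂ : Triangle.mk (-T.mor₂) (-T.mor₃) (-T.mor₁⟦(1 : ℤ)⟧') ∈ distTriang C := by
    refine isomorphic_distinguished _ (rot_of_distTriang _ hT) _
      (Triangle.isoMk _ _ (Iso.refl _) (-Iso.refl _) (Iso.refl _) ?_ ?_ ?_)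
    · change (-T.mor₂) ≫ (-𝟙 T.obj₃) = 𝟙 T.obj₂ ≫ T.mor₂
      simp
    · change (-T.mor₃) ≫ 𝟙 _ = (-𝟙 T.obj₃) ≫ T.mor₃
      simp
    · change (-T.mor₁⟦(1 : ℤ)⟧') ≫ (𝟙 T.obj₂)⟦(1 : ℤ)⟧' = 𝟙 _ ≫ (-T.mor₁⟦(1 : ℤ)⟧')
      simp
  refine isGood_mk (u := biprod.map T.mor₁ T'.mor₁) (v := biprod.map T.mor₂ T'.mor₂)
    (w := biprod.desc (T.mor₃ ≫ biprod.inl⟦(1 : ℤ)⟧') (T'.mor₃ ≫ biprod.inr⟦(1 : ℤ)⟧'))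
    (u' := T'.mor₁) (v' := T'.mor₂) (w' := T'.mor₃)
    (f := biprod.snd) (g := biprod.snd) (h := biprod.snd) ?_
  refine dist_of_biprod hid hT₂
    (biprod.map (𝟙 _) biprod.snd) (biprod.map (𝟙 _) biprod.snd)
    (biprod.map (𝟙 _) (biprod.snd⟦(1 : ℤ)⟧'))
    (biprod.snd ≫ biprod.fst) (biprod.snd ≫ biprod.fst) (biprod.snd ≫ biprod.fst⟦(1 : ℤ)⟧')
    (biprod.map (𝟙 _) biprod.inr) (biprod.map (𝟙 _) biprod.inr)
    (biprod.map (𝟙 _) (biprod.inr⟦(1 : ℤ)⟧'))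
    (biprod.inl ≫ biprod.inr) (biprod.inl ≫ biprod.inr) (biprod.inl⟦(1 : ℤ)⟧' ≫ biprod.inr)
    ?_ ?_ ?_ ?_ ?_ ?_ ?_ ?_ ?_ ?_ ?_ ?_ ?_ ?_ ?_ ?_ ?_ ?_ ?_ ?_ ?_
  all_goals try ext
  all_goals simp [← Functor.map_comp]
  rw [← Functor.map_add, add_comm, biprod.total, CategoryTheory.Functor.map_id]

lemma isVerdierGood_lift (hT : T ∈ distTriang C) (hT' : T' ∈ distTriang C)
    (hmap : IsTriMap T T' f g h) :
    IsVerdierGood T (biprodTriangle T T') (biprod.lift (𝟙 _) f) (biprod.lift (𝟙 _) g)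
      (biprod.lift (𝟙 _) h) := by
  obtain ⟨h₁, h₂, h₃⟩ := hmap
  refine isVerdierGood_mk (u := T.mor₁) (v := T.mor₂) (w := T.mor₃)
    (u' := biprod.map T.mor₁ T'.mor₁) (v' := biprod.map T.mor₂ T'.mor₂)
    (w' := biprod.desc (T.mor₃ ≫ biprod.inl⟦(1 : ℤ)⟧') (T'.mor₃ ≫ biprod.inr⟦(1 : ℤ)⟧'))
    (f := biprod.lift (𝟙 T.obj₁) f) (g := biprod.lift (𝟙 T.obj₂) g)
    (h := biprod.lift (𝟙 T.obj₃) h)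
    (vt := biprod.desc (T.mor₂ ≫ biprod.inl - g ≫ biprod.inr) biprod.inr)
    (wt := biprod.desc T.mor₃ 0)
    (α₁ := biprod.inl) (β₁ := biprod.snd) (α₂ := T'.mor₁ ≫ biprod.inr)
    (β₂ := biprod.desc (biprod.lift (𝟙 _) h) (T'.mor₂ ≫ biprod.inr))
    ?_ (lift_desc_neg_distinguished g) (lift_desc_neg_distinguished f)
    ⟨?_, ?_, ?_, ?_, ?_⟩ ⟨?_, ?_, ?_, ?_, ?_⟩ ?_
  · refine dist_of_biprod hT (contractible_distinguished₁ T'.obj₂)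
      (𝟙 _) biprod.fst biprod.fst 0 (biprod.desc (-g) (𝟙 _)) biprod.snd
      (𝟙 _) (biprod.lift (𝟙 _) g) biprod.inl 0 biprod.inr biprod.inr
      ?_ ?_ ?_ ?_ ?_ ?_ ?_ ?_ ?_ ?_ ?_ ?_ ?_ ?_ ?_ ?_ ?_ ?_ ?_ ?_ ?_
    all_goals try exact (isZero_zero C).eq_of_src _ _
    all_goals try ext
    all_goals simp
  · ext <;> simp
  · simp
  · ext <;> simp
  · ext <;> simp [comp_distTriang_mor_zero₃₁ T hT]
  · simpa [binaryBiproductTriangle] using binaryBiproductTriangle_distinguished T.obj₃ T'.obj₂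
  · ext <;> simp [h₁, comp_distTriang_mor_zero₁₂ T hT]
  · simp
  · ext <;> simp [h₂]
  · ext <;> simp [biprod.lift_eq, ← reassoc_of% h₃, comp_distTriang_mor_zero₂₃_assoc T' hT']
  · refine dist_of_biprod hT' (contractible_distinguished₁ T.obj₃)
      (𝟙 _) biprod.snd (biprod.desc (-h) (𝟙 _)) 0 biprod.fst biprod.fst
      (𝟙 _) biprod.inr biprod.inr 0 biprod.inl (biprod.lift (𝟙 _) h)
      ?_ ?_ ?_ ?_ ?_ ?_ ?_ ?_ ?_ ?_ ?_ ?_ ?_ ?_ ?_ ?_ ?_ ?_ ?_ ?_ ?_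
    all_goals try exact (isZero_zero C).eq_of_src _ _
    all_goals try ext
    all_goals simp [← Functor.map_comp, h₃]
  · simp

lemma isVerdierGood_snd (hT : T ∈ distTriang C) (hT' : T' ∈ distTriang C) :
    IsVerdierGood (biprodTriangle T T') T' biprod.snd biprod.snd biprod.snd := by
  have hT₃ : Triangle.mk T.mor₃ (T.mor₁⟦(1 : ℤ)⟧') (T.mor₂⟦(1 : ℤ)⟧') ∈ distTriang C := by
    refine isomorphic_distinguished _ (rot_of_distTriang _ (rot_of_distTriang _ hT)) _
      (Triangle.isoMk _ _ (Iso.refl _) (Iso.refl _) (-Iso.refl _) ?_ ?_ ?_)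
    · change T.mor₃ ≫ 𝟙 _ = 𝟙 _ ≫ T.mor₃
      simp
    · change T.mor₁⟦(1 : ℤ)⟧' ≫ (-𝟙 _) = 𝟙 _ ≫ (-T.mor₁⟦(1 : ℤ)⟧')
      simp
    · change T.mor₂⟦(1 : ℤ)⟧' ≫ (𝟙 T.obj₃)⟦(1 : ℤ)⟧' = (-𝟙 _) ≫ (-T.mor₂⟦(1 : ℤ)⟧')
      simp
  refine isVerdierGood_mk (u := biprod.map T.mor₁ T'.mor₁) (v := biprod.map T.mor₂ T'.mor₂)
    (w := biprod.desc (T.mor₃ ≫ biprod.inl⟦(1 : ℤ)⟧') (T'.mor₃ ≫ biprod.inr⟦(1 : ℤ)⟧'))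
    (u' := T'.mor₁) (v' := T'.mor₂) (w' := T'.mor₃)
    (f := biprod.snd) (g := biprod.snd) (h := biprod.snd)
    (vt := T'.mor₂ ≫ biprod.inr)
    (wt := biprod.desc (biprod.inl⟦(1 : ℤ)⟧') (T'.mor₃ ≫ biprod.inr⟦(1 : ℤ)⟧'))
    (α₁ := biprod.map T.mor₃ (𝟙 _)) (β₁ := biprod.desc (T.mor₁⟦(1 : ℤ)⟧') 0)
    (α₂ := biprod.inl) (β₂ := biprod.snd)
    ?_ (biprod_snd_shift_inl_distinguished _ _) (biprod_snd_shift_inl_distinguished _ _)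
    ⟨?_, ?_, ?_, ?_, ?_⟩ ⟨?_, ?_, ?_, ?_, ?_⟩ ?_
  · refine dist_of_biprod hT' (contractible_distinguished₂ T.obj₁)
      biprod.snd (𝟙 _) biprod.snd biprod.fst 0 biprod.fst
      biprod.inr (𝟙 _) biprod.inr biprod.inl 0 biprod.inl
      ?_ ?_ ?_ ?_ ?_ ?_ ?_ ?_ ?_ ?_ ?_ ?_ ?_ ?_ ?_ ?_ ?_ ?_ ?_ ?_ ?_
    all_goals try exact (isZero_zero C).eq_of_src _ _
    all_goals try ext
    all_goals simp [← Functor.map_comp]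
  · ext <;> simp [comp_distTriang_mor_zero₂₃ T hT]
  · ext <;> simp
  · simp
  · ext <;> simp [← Functor.map_comp]
    simp [comp_distTriang_mor_zero₃₁_assoc T' hT']
  · refine dist_of_biprod hT₃ (contractible_distinguished T'.obj₃)
      biprod.fst biprod.fst (𝟙 _) biprod.snd biprod.snd 0
      biprod.inl biprod.inl (𝟙 _) biprod.inr biprod.inr 0
      ?_ ?_ ?_ ?_ ?_ ?_ ?_ ?_ ?_ ?_ ?_ ?_ ?_ ?_ ?_ ?_ ?_ ?_ ?_ ?_ ?_
    all_goals try exact (isZero_zero C).eq_of_src _ _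
    all_goals try ext
    all_goals simp [← Functor.map_comp]
  · simp [comp_distTriang_mor_zero₁₂_assoc T' hT']
  · simp
  · simp
  · ext <;> simp [← Functor.map_comp]
  · simpa [binaryBiproductTriangle] using
      binaryBiproductTriangle_distinguished (T.obj₁⟦(1 : ℤ)⟧) T'.obj₃
  · simp

end

theorem stmt_7 (T T' : Triangle C)
    (hT : T ∈ distTriang C) (hT' : T' ∈ distTriang C)
    (f : T.obj₁ ⟶ T'.obj₁) (g : T.obj₂ ⟶ T'.obj₂) (h : T.obj₃ ⟶ T'.obj₃)
    (hmap : IsTriMap T T' f g h) :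
    ∃ T₂ : Triangle C, (T₂ ∈ distTriang C) ∧
      ∃ (f₁ : T.obj₁ ⟶ T₂.obj₁) (g₁ : T.obj₂ ⟶ T₂.obj₂) (h₁ : T.obj₃ ⟶ T₂.obj₃)
        (f₂ : T₂.obj₁ ⟶ T'.obj₁) (g₂ : T₂.obj₂ ⟶ T'.obj₂) (h₂ : T₂.obj₃ ⟶ T'.obj₃),
        IsTriMap T T₂ f₁ g₁ h₁ ∧ IsTriMap T₂ T' f₂ g₂ h₂ ∧
        IsGood T T₂ f₁ g₁ h₁ ∧ IsVerdierGood T T₂ f₁ g₁ h₁ ∧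
        IsGood T₂ T' f₂ g₂ h₂ ∧ IsVerdierGood T₂ T' f₂ g₂ h₂ ∧
        f = f₁ ≫ f₂ ∧ g = g₁ ≫ g₂ ∧ h = h₁ ≫ h₂ := by
  exact ⟨biprodTriangle T T', biprodTriangle_distinguished hT hT', biprod.lift (𝟙 _) f,
    biprod.lift (𝟙 _) g, biprod.lift (𝟙 _) h, biprod.snd, biprod.snd, biprod.snd,
    isTriMap_lift hmap, isTriMap_snd T T', isGood_lift hT hT' hmap,
    isVerdierGood_lift hT hT' hmap, isGood_snd hT hT', isVerdierGood_snd hT hT',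
    (biprod.lift_snd _ _).symm, (biprod.lift_snd _ _).symm, (biprod.lift_snd _ _).symm⟩
end
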